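/- arXiv:1405.3363 — 4 statements merged into one kernel-verified Lean document; each statement's English description precedes it below -/
import Mathlib

section
/- For every fixed x ∈ X, the map λ ↦ J^λ(x) is convex and piecewise linear on {λ ∈ ℝ^L : λ ≥ 0}: there exists a finite family of affine functions of λ, not depending on λ, whose pointwise maximum equals J^λ(x) for every λ ≥ 0; in particular, for all λ₁, λ₂ ≥ 0 componentwise and t ∈ [0,1], J^{t·λ₁+(1−t)·λ₂}(x) ≤ t·J^{λ₁}(x) + (1−t)·J^{λ₂}(x). -/
open MeasureTheory ProbabilityTheory

noncomputable section

/-- Euclidean inner product on `ℝ^L`. -/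
def dotL {L : ℕ} (u v : Fin L → ℝ) : ℝ := ∑ i, u i * v i

/-- Expected value `E[H|x,a] = Σ_y P x a y · H y`. -/
def expH {X Act : Type*} [Fintype X] (P : X → Act → X → ℝ) (H : X → ℝ) (x : X) (a : Act) : ℝ :=
  ∑ y, P x a y * H y

theorem nonneg_of_discounted_le {X : Type*} [Fintype X] {Q : X → X → ℝ}
    (hQ0 : ∀ x y, 0 ≤ Q x y) (hQ1 : ∀ x, ∑ y, Q x y = 1)
    {β : ℝ} (hβ0 : 0 ≤ β) (hβ1 : β < 1) {D : X → ℝ}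
    (hD : ∀ x, β * ∑ y, Q x y * D y ≤ D x) (x : X) : 0 ≤ D x := by
  have : Nonempty X := ⟨x⟩
  obtain ⟨m, hm⟩ := Finite.exists_min D
  have h1 : D m ≤ ∑ y, Q m y * D y := by
    calc D m = ∑ y, Q m y * D m := by rw [← Finset.sum_mul, hQ1, one_mul]
      _ ≤ _ := Finset.sum_le_sum fun y _ => mul_le_mul_of_nonneg_left (hm y) (hQ0 m y)
  have h2 := mul_le_mul_of_nonneg_left h1 hβ0
  have h3 := hD m
  have h4 : 0 ≤ D m := by nlinarith
  exact h4.trans (hm x)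

/-- The operator `V ↦ V - β Q V` on functions on the state space. -/
def discountedLaplacian {X : Type*} [Fintype X] (Q : X → X → ℝ) (β : ℝ) :
    (X → ℝ) →ₗ[ℝ] (X → ℝ) where
  toFun V x := V x - β * ∑ y, Q x y * V y
  map_add' V W := by
    ext x
    simp only [Pi.add_apply, mul_add, Finset.sum_add_distrib]
    ring
  map_smul' r V := by
    ext x
    simp only [Pi.smul_apply, smul_eq_mul, RingHom.id_apply, mul_left_comm _ r,
      ← Finset.mul_sum]
    ring

theorem discountedLaplacian_le_imp_le {X : Type*} [Fintype X] {Q : X → X → ℝ}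
    (hQ0 : ∀ x y, 0 ≤ Q x y) (hQ1 : ∀ x, ∑ y, Q x y = 1)
    {β : ℝ} (hβ0 : 0 ≤ β) (hβ1 : β < 1) {V W : X → ℝ}
    (h : discountedLaplacian Q β V ≤ discountedLaplacian Q β W) : V ≤ W := by
  intro x
  refine sub_nonneg.mp (nonneg_of_discounted_le hQ0 hQ1 hβ0 hβ1 (D := fun x => W x - V x)
    (fun z => ?_) x)
  have hz : V z - β * ∑ y, Q z y * V y ≤ W z - β * ∑ y, Q z y * W y := h z
  simp only [mul_sub, Finset.sum_sub_distrib]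
  linarith

theorem exists_discountedLaplacian_rightInverse {X : Type*} [Fintype X] {Q : X → X → ℝ}
    (hQ0 : ∀ x y, 0 ≤ Q x y) (hQ1 : ∀ x, ∑ y, Q x y = 1)
    {β : ℝ} (hβ0 : 0 ≤ β) (hβ1 : β < 1) :
    ∃ S : (X → ℝ) →ₗ[ℝ] (X → ℝ), ∀ r, discountedLaplacian Q β (S r) = r := by
  have hinj : Function.Injective (discountedLaplacian Q β) := fun V W h =>
    le_antisymm (discountedLaplacian_le_imp_le hQ0 hQ1 hβ0 hβ1 h.le)
      (discountedLaplacian_le_imp_le hQ0 hQ1 hβ0 hβ1 h.ge)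
  exact ⟨(LinearEquiv.ofInjectiveEndo _ hinj).symm,
    (LinearEquiv.ofInjectiveEndo _ hinj).apply_symm_apply⟩

theorem iSup_affine_convex {L : ℕ} {ι : Type*} [Finite ι] [Nonempty ι]
    (c : ι → ℝ) (w : ι → Fin L → ℝ) (u v : Fin L → ℝ) {t : ℝ} (ht0 : 0 ≤ t) (ht1 : t ≤ 1) :
    (⨆ j, (c j + dotL (w j) (fun i => t * u i + (1 - t) * v i))) ≤
      t * (⨆ j, (c j + dotL (w j) u)) + (1 - t) * ⨆ j, (c j + dotL (w j) v) := by
  refine ciSup_le fun j => ?_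
  have hu := le_ciSup (Set.finite_range fun j => c j + dotL (w j) u).bddAbove j
  have hv := le_ciSup (Set.finite_range fun j => c j + dotL (w j) v).bddAbove j
  have hlin : dotL (w j) (fun i => t * u i + (1 - t) * v i) =
      t * dotL (w j) u + (1 - t) * dotL (w j) v := by
    simp only [dotL, Finset.mul_sum, ← Finset.sum_add_distrib]
    exact Finset.sum_congr rfl fun i _ => by ring
  have h1 := mul_le_mul_of_nonneg_left hu ht0
  have h2 := mul_le_mul_of_nonneg_left hv (sub_nonneg.mpr ht1)
  rw [hlin]
  linarith

/-- for fixed `x`, `λ ↦ J^λ(x)` is convex and piecewise linear on `{λ ≥ 0}`: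
it is the pointwise maximum of a finite (nonempty) family of affine functions of `λ`,
and it satisfies the convexity inequality. -/
theorem lagrangian_convex_piecewise_linear
    {X Act : Type*} [Fintype X] [Fintype Act] [Nonempty X] [Nonempty Act]
    {L : ℕ}
    (A : X → Set Act) (hA : ∀ x, (A x).Nonempty)
    (P : X → Act → X → ℝ)
    (hP0 : ∀ x a y, 0 ≤ P x a y) (hP1 : ∀ x a, ∑ y, P x a y = 1)
    (R : X → Act → ℝ)
    (β : ℝ) (hβ0 : 0 < β) (hβ1 : β < 1)
    (B : X → Act → Fin L → ℝ) (b : Fin L → ℝ)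
    (J : (Fin L → ℝ) → X → ℝ)
    (hJ : ∀ lam : Fin L → ℝ, (∀ i, 0 ≤ lam i) → ∀ x, J lam x = ⨆ a : A x,
      (R x a + dotL lam (fun i => b i - B x a i) + β * expH P (J lam) x a))
    (x : X) :
    (∃ k : ℕ, 0 < k ∧ ∃ (c : Fin k → ℝ) (w : Fin k → Fin L → ℝ),
        ∀ lam : Fin L → ℝ, (∀ i, 0 ≤ lam i) →
          J lam x = ⨆ j : Fin k, (c j + dotL (w j) lam)) ∧
    (∀ lam₁ lam₂ : Fin L → ℝ, (∀ i, 0 ≤ lam₁ i) → (∀ i, 0 ≤ lam₂ i) →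
      ∀ t : ℝ, 0 ≤ t → t ≤ 1 →
        J (fun i => t * lam₁ i + (1 - t) * lam₂ i) x ≤ t * J lam₁ x + (1 - t) * J lam₂ x) := by
  have hpoly : ∃ k : ℕ, 0 < k ∧ ∃ (c : Fin k → ℝ) (w : Fin k → Fin L → ℝ),
      ∀ lam : Fin L → ℝ, (∀ i, 0 ≤ lam i) →
        J lam x = ⨆ j : Fin k, (c j + dotL (w j) lam) := by
    have : ∀ z, Nonempty (A z) := fun z => (hA z).to_subtype
    let Pol := ∀ z, A z
    obtain ⟨k, ⟨e⟩⟩ := Finite.exists_equiv_fin Pol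
    have hk : 0 < k := Fin.pos (e (Classical.arbitrary Pol))
    have : Nonempty (Fin k) := ⟨⟨0, hk⟩⟩
    have hS : ∀ π : Pol, ∃ S : (X → ℝ) →ₗ[ℝ] (X → ℝ), ∀ r,
        discountedLaplacian (fun z => P z (π z)) β (S r) = r := fun π =>
      exists_discountedLaplacian_rightInverse (fun z => hP0 z _) (fun z => hP1 z _) hβ0.le hβ1
    choose S hS using hS
    let r (π : Pol) (lam : Fin L → ℝ) : X → ℝ := fun z =>
      R z (π z) + dotL lam (fun i => b i - B z (π z) i)
    have haff : ∀ π lam, S π (r π lam) x = S π (fun z => R z (π z)) x +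
        dotL (fun i => S π (fun z => b i - B z (π z) i) x) lam := by
      intro π lam
      have hr : r π lam = (fun z => R z (π z)) +
          ∑ i, lam i • (fun z => b i - B z (π z) i) := by
        ext z
        simp [r, dotL]
      rw [hr, map_add, map_sum]
      simp [dotL, mul_comm]
    refine ⟨k, hk, fun j => S (e.symm j) (fun z => R z (e.symm j z)) x,
      fun j i => S (e.symm j) (fun z => b i - B z (e.symm j z) i) x, fun lam hlam => ?_⟩
    simp only [← haff]
    apply le_antisymm
    · have hmax : ∀ z, ∃ a : A z, J lam z =
          R z a + dotL lam (fun i => b i - B z a i) + β * expH P (J lam) z a := by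
        intro z
        obtain ⟨a, ha⟩ := exists_eq_ciSup_of_finite (f := fun a : A z =>
          R z a + dotL lam (fun i => b i - B z a i) + β * expH P (J lam) z a)
        exact ⟨a, (hJ lam hlam z).trans ha.symm⟩
      choose π hπ using hmax
      have hle : J lam ≤ S π (r π lam) := by
        refine discountedLaplacian_le_imp_le (Q := fun z => P z (π z))
          (fun z => hP0 z _) (fun z => hP1 z _) hβ0.le hβ1 ?_
        rw [hS]
        exact fun z => (sub_eq_iff_eq_add.mpr (hπ z)).le
      have hsup := le_ciSup
        (Set.finite_range fun j => S (e.symm j) (r (e.symm j) lam) x).bddAbove (e π)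
      simp only [e.symm_apply_apply] at hsup
      exact (hle x).trans hsup
    · refine ciSup_le fun j => ?_
      generalize e.symm j = π
      refine discountedLaplacian_le_imp_le (Q := fun z => P z (π z))
        (fun z => hP0 z _) (fun z => hP1 z _) hβ0.le hβ1 ?_ x
      rw [hS]
      intro z
      refine le_sub_iff_add_le.mpr ?_
      rw [hJ lam hlam z]
      exact le_ciSup (f := fun a : A z =>
        R z a + dotL lam (fun i => b i - B z a i) + β * expH P (J lam) z a)
        (Set.finite_range _).bddAbove (π z)
  refine ⟨hpoly, fun u v hu hv t ht0 ht1 => ?_⟩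
  obtain ⟨k, hk, c, w, h⟩ := hpoly
  have : Nonempty (Fin k) := ⟨⟨0, hk⟩⟩
  rw [h u hu, h v hv, h _ fun i => add_nonneg (mul_nonneg ht0 (hu i))
    (mul_nonneg (sub_nonneg.mpr ht1) (hv i))]
  exact iSup_affine_convex c w u v ht0 ht1
end
end

section
/- In the weakly coupled setting, the Lagrangian relaxation decomposes additively across subproblems: for every λ ∈ ℝ^L with λ ≥ 0 componentwise and every x = (x^1,…,x^N) ∈ X, J^λ(x) = λ·b/(1−β) + Σ_{n=1}^{N} H^{λ,n}(x^n). -/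
open MeasureTheory ProbabilityTheory

noncomputable section

/-- The expectation of a function of one coordinate under a product of probability weights is
its expectation under the marginal. -/
theorem sum_prod_mul_apply {ι : Type*} [Fintype ι] [DecidableEq ι] {X : ι → Type*}
    [∀ i, Fintype (X i)] (p h : ∀ i, X i → ℝ) (hp : ∀ i, ∑ z, p i z = 1) (n : ι) :
    ∑ y : ∀ i, X i, (∏ i, p i (y i)) * h n (y n) = ∑ z, p n z * h n z := by
  have key := Fintype.prod_sum (fun i z => p i z * if i = n then h i z else 1)
  have hmarg : ∏ i, ∑ z, p i z * (if i = n then h i z else 1) = ∑ z, p n z * h n z := by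
    rw [Finset.prod_eq_single n]
    · simp
    · intro i _ hi
      simp [hi, hp]
    · simp
  rw [← hmarg, key]
  refine Finset.sum_congr rfl fun y _ => ?_
  rw [Finset.prod_mul_distrib, Finset.prod_ite_eq' Finset.univ n fun i => h i (y i)]
  simp

/-- The expectation of an additively separable function under a product of probability weights. -/
theorem sum_prod_mul_sum {ι : Type*} [Fintype ι] [DecidableEq ι] {X : ι → Type*}
    [∀ i, Fintype (X i)] (p h : ∀ i, X i → ℝ) (hp : ∀ i, ∑ z, p i z = 1) (c : ℝ) :
    ∑ y : ∀ i, X i, (∏ i, p i (y i)) * (c + ∑ n, h n (y n)) = c + ∑ n, ∑ z, p n z * h n z := by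
  have hone : ∑ y : ∀ i, X i, ∏ i, p i (y i) = 1 := by
    rw [← Fintype.prod_sum]
    simp [hp]
  simp_rw [mul_add, Finset.sum_add_distrib, Finset.mul_sum, ← Finset.sum_mul, hone, one_mul]
  rw [Finset.sum_comm]
  simp_rw [sum_prod_mul_apply p h hp]

/-- The supremum of an additively separable function over a product of nonempty finite sets. -/
theorem ciSup_const_add_sum {ι : Type*} [Fintype ι] {A : ι → Type*} [∀ i, Finite (A i)]
    (S : ∀ i, Set (A i)) (hS : ∀ i, (S i).Nonempty) (g : ∀ i, A i → ℝ) (c : ℝ) :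
    ⨆ a : {a : ∀ i, A i // ∀ i, a i ∈ S i}, (c + ∑ i, g i (a.1 i)) =
      c + ∑ i, ⨆ a : S i, g i a := by
  have : ∀ i, Nonempty (S i) := fun i => (hS i).to_subtype
  have hmax : ∀ i, ∃ a : S i, g i a = ⨆ a : S i, g i a := fun i => exists_eq_ciSup_of_finite
  choose m hm using hmax
  let m' : {a : ∀ i, A i // ∀ i, a i ∈ S i} := ⟨fun i => m i, fun i => (m i).2⟩
  have : Nonempty {a : ∀ i, A i // ∀ i, a i ∈ S i} := ⟨m'⟩
  apply le_antisymm
  · refine ciSup_le fun a => ?_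
    gcongr with i
    exact le_ciSup (f := fun a : S i => g i a) (Set.finite_range _).bddAbove ⟨a.1 i, a.2 i⟩
  · simp_rw [← hm]
    exact le_ciSup (f := fun a : {a : ∀ i, A i // ∀ i, a i ∈ S i} => c + ∑ i, g i (a.1 i))
      (Set.finite_range _).bddAbove m'

/-- Comparison of two solutions of a finite discounted Bellman equation. -/
theorem bellman_solution_le {X : Type*} [Fintype X] {A : X → Type*}
    [∀ x, Finite (A x)] [∀ x, Nonempty (A x)] (r : ∀ x, A x → ℝ) (p : ∀ x, A x → X → ℝ)
    (hp0 : ∀ x a y, 0 ≤ p x a y) (hp1 : ∀ x a, ∑ y, p x a y = 1)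
    {β : ℝ} (hβ0 : 0 ≤ β) (hβ1 : β < 1) (F G : X → ℝ)
    (hF : ∀ x, F x = ⨆ a, (r x a + β * ∑ y, p x a y * F y))
    (hG : ∀ x, G x = ⨆ a, (r x a + β * ∑ y, p x a y * G y)) (x : X) : F x ≤ G x := by
  have : Nonempty X := ⟨x⟩
  obtain ⟨x₀, hx₀⟩ := Finite.exists_max fun y => F y - G y
  obtain ⟨a, ha⟩ := exists_eq_ciSup_of_finite (f := fun a => r x₀ a + β * ∑ y, p x₀ a y * F y)
  rw [← hF] at ha
  have hGa : r x₀ a + β * ∑ y, p x₀ a y * G y ≤ G x₀ := by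
    rw [hG x₀]
    exact le_ciSup (f := fun a => r x₀ a + β * ∑ y, p x₀ a y * G y)
      (Set.finite_range _).bddAbove a
  have hsum : ∑ y, p x₀ a y * F y ≤ ∑ y, p x₀ a y * G y + (F x₀ - G x₀) := by
    calc ∑ y, p x₀ a y * F y ≤ ∑ y, p x₀ a y * (G y + (F x₀ - G x₀)) :=
          Finset.sum_le_sum fun y _ =>
            mul_le_mul_of_nonneg_left (by linarith [hx₀ y]) (hp0 x₀ a y)
      _ = ∑ y, p x₀ a y * G y + (F x₀ - G x₀) := by
          simp_rw [mul_add, Finset.sum_add_distrib, ← Finset.sum_mul, hp1, one_mul]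
  have hmul := mul_le_mul_of_nonneg_left hsum hβ0
  have hgap : F x₀ - G x₀ ≤ 0 := by nlinarith
  linarith [hx₀ x]

/-- A finite discounted Bellman equation has at most one solution. -/
theorem bellman_solution_unique {X : Type*} [Fintype X] {A : X → Type*}
    [∀ x, Finite (A x)] [∀ x, Nonempty (A x)] (r : ∀ x, A x → ℝ) (p : ∀ x, A x → X → ℝ)
    (hp0 : ∀ x a y, 0 ≤ p x a y) (hp1 : ∀ x a, ∑ y, p x a y = 1)
    {β : ℝ} (hβ0 : 0 ≤ β) (hβ1 : β < 1) (F G : X → ℝ)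
    (hF : ∀ x, F x = ⨆ a, (r x a + β * ∑ y, p x a y * F y))
    (hG : ∀ x, G x = ⨆ a, (r x a + β * ∑ y, p x a y * G y)) (x : X) : F x = G x :=
  le_antisymm (bellman_solution_le r p hp0 hp1 hβ0 hβ1 F G hF hG x)
    (bellman_solution_le r p hp0 hp1 hβ0 hβ1 G F hG hF x)

theorem dotL_sub_sum {L : ℕ} {ι : Type*} [Fintype ι] (u v : Fin L → ℝ) (w : ι → Fin L → ℝ) :
    dotL u (fun i => v i - ∑ n, w n i) = dotL u v - ∑ n, dotL u (w n) := by
  simp_rw [dotL, mul_sub, Finset.sum_sub_distrib, Finset.mul_sum]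
  rw [Finset.sum_comm]

/-- in the weakly coupled setting the Lagrangian relaxation decomposes
additively: `J^λ(x) = λ·b/(1−β) + Σ_n H^{λ,n}(x^n)`. -/
theorem lagrangian_decomposition
    {N : ℕ} {Xn Actn : Fin N → Type*}
    [∀ n, Fintype (Xn n)] [∀ n, Fintype (Actn n)]
    [∀ n, Nonempty (Xn n)] [∀ n, Nonempty (Actn n)]
    {L : ℕ}
    (An : ∀ n, Xn n → Set (Actn n)) (hAn : ∀ n x, (An n x).Nonempty)
    (Pn : ∀ n, Xn n → Actn n → Xn n → ℝ)
    (hPn0 : ∀ n x a y, 0 ≤ Pn n x a y) (hPn1 : ∀ n x a, ∑ y, Pn n x a y = 1)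
    (Rn : ∀ n, Xn n → Actn n → ℝ)
    (Bn : ∀ n, Xn n → Actn n → Fin L → ℝ)
    (b : Fin L → ℝ)
    (β : ℝ) (hβ0 : 0 < β) (hβ1 : β < 1)
    (lam : Fin L → ℝ) (hlam : ∀ i, 0 ≤ lam i)
    -- the joint Lagrangian relaxation on the product state space
    (J : (∀ n, Xn n) → ℝ)
    (hJ : ∀ x : ∀ n, Xn n, J x =
      ⨆ a : {a : ∀ n, Actn n // ∀ n, a n ∈ An n (x n)},
        ((∑ n, Rn n (x n) (a.1 n)) +
          dotL lam (fun i => b i - ∑ n, Bn n (x n) (a.1 n) i) +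
          β * expH (fun (x : ∀ n, Xn n) (a : ∀ n, Actn n) (y : ∀ n, Xn n) =>
              ∏ n, Pn n (x n) (a n) (y n)) J x a.1))
    -- the subproblem Lagrangian value functions
    (Hn : ∀ n, Xn n → ℝ)
    (hHn : ∀ n (x : Xn n), Hn n x = ⨆ a : An n x,
      (Rn n x a - dotL lam (Bn n x a) + β * ∑ y, Pn n x a y * Hn n y)) :
    ∀ x : ∀ n, Xn n, J x = dotL lam b / (1 - β) + ∑ n, Hn n (x n) := by
  have : ∀ x : ∀ n, Xn n, Nonempty {a : ∀ n, Actn n // ∀ n, a n ∈ An n (x n)} := fun x =>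
    ⟨⟨fun n => (hAn n (x n)).some, fun n => (hAn n (x n)).some_mem⟩⟩
  refine bellman_solution_unique
    (A := fun x : ∀ n, Xn n => {a : ∀ n, Actn n // ∀ n, a n ∈ An n (x n)})
    (fun x a => (∑ n, Rn n (x n) (a.1 n)) +
      dotL lam (fun i => b i - ∑ n, Bn n (x n) (a.1 n) i))
    (fun x a y => ∏ n, Pn n (x n) (a.1 n) (y n))
    (fun x a y => Finset.prod_nonneg fun n _ => hPn0 n _ _ _)
    (fun x a => ?_) hβ0.le hβ1 J (fun x => dotL lam b / (1 - β) + ∑ n, Hn n (x n)) hJ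
    fun x => ?_
  · rw [← Fintype.prod_sum fun n z => Pn n (x n) (a.1 n) z]
    simp [hPn1]
  · have hsup := ciSup_const_add_sum (fun n => An n (x n)) (fun n => hAn n (x n))
      (fun n a => Rn n (x n) a - dotL lam (Bn n (x n) a) + β * ∑ y, Pn n (x n) a y * Hn n y)
      (dotL lam b / (1 - β))
    simp_rw [← hHn] at hsup
    rw [← hsup]
    refine iSup_congr fun a => ?_
    have hβ : 1 - β ≠ 0 := by linarith
    rw [sum_prod_mul_sum (fun n => Pn n (x n) (a.1 n)) Hn (fun n => hPn1 n _ _),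
      dotL_sub_sum, Finset.sum_add_distrib, Finset.sum_sub_distrib, ← Finset.mul_sum]
    field_simp
    ring
end
end

section
/- Optimality characterization for the Lagrangian bound: let λ ∈ ℝ^L with λ ≥ 0 componentwise and let α be a stationary feasible policy. Then V_α(x) = J^λ(x) for all x ∈ X if and only if for every x ∈ X both λ·(b − B x (α x)) = 0 (complementary slackness) and α(x) ∈ argmax_{a ∈ A(x)} ( R x a + λ·(b − B x a) + β·E[J^λ|x,a] ). -/
open MeasureTheory ProbabilityTheory

noncomputable section

/-- Feasible action set `Ā(x) = {a ∈ A x : B x a ≤ b componentwise}`. -/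
def Abar {X Act : Type*} {L : ℕ} (A : X → Set Act) (B : X → Act → Fin L → ℝ)
    (b : Fin L → ℝ) (x : X) : Set Act :=
  {a ∈ A x | ∀ i, B x a i ≤ b i}

/-- A function fixed by a discounted averaging operator on a finite type vanishes. -/
theorem eq_zero_of_eq_discounted_average {X : Type*} [Fintype X] (p : X → X → ℝ)
    (hp0 : ∀ x y, 0 ≤ p x y) (hp1 : ∀ x, ∑ y, p x y = 1) {β : ℝ} (hβ0 : 0 ≤ β) (hβ1 : β < 1)
    {d : X → ℝ} (hd : ∀ x, d x = β * ∑ y, p x y * d y) (x : X) : d x = 0 := by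
  have : Nonempty X := ⟨x⟩
  obtain ⟨m, hm⟩ := Finite.exists_max fun y => |d y|
  have hle : |d m| ≤ β * |d m| := by
    calc |d m| = β * |∑ y, p m y * d y| := by
          conv_lhs => rw [hd m, abs_mul, abs_of_nonneg hβ0]
      _ ≤ β * ∑ y, p m y * |d m| := by
          gcongr
          refine (Finset.abs_sum_le_sum_abs _ _).trans (Finset.sum_le_sum fun y _ => ?_)
          rw [abs_mul, abs_of_nonneg (hp0 m y)]
          exact mul_le_mul_of_nonneg_left (hm y) (hp0 m y)
      _ = β * |d m| := by rw [← Finset.sum_mul, hp1, one_mul]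
  have hxm := hm x
  have hzero : |d x| = 0 := by
    nlinarith [abs_nonneg (d x), abs_nonneg (d m)]
  exact abs_eq_zero.mp hzero

/-- optimality characterization for the Lagrangian bound:
`V_α = J^λ` iff complementary slackness holds and `α` is greedy for `J^λ`. -/
theorem lagrangian_optimality_characterization
    {X Act : Type*} [Fintype X] [Fintype Act] [Nonempty X] [Nonempty Act]
    {L : ℕ}
    (A : X → Set Act) (hA : ∀ x, (A x).Nonempty)
    (P : X → Act → X → ℝ)
    (hP0 : ∀ x a y, 0 ≤ P x a y) (hP1 : ∀ x a, ∑ y, P x a y = 1)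
    (R : X → Act → ℝ)
    (β : ℝ) (hβ0 : 0 < β) (hβ1 : β < 1)
    (B : X → Act → Fin L → ℝ) (b : Fin L → ℝ)
    (hAbar : ∀ x, (Abar A B b x).Nonempty)
    (lam : Fin L → ℝ) (hlam : ∀ i, 0 ≤ lam i)
    (J : X → ℝ)
    (hJ : ∀ x, J x = ⨆ a : A x,
      (R x a + dotL lam (fun i => b i - B x a i) + β * expH P J x a))
    (pol : X → Act) (hpol : ∀ x, pol x ∈ Abar A B b x)
    (Vpol : X → ℝ)
    (hVpol : ∀ x, Vpol x = R x (pol x) + β * expH P Vpol x (pol x)) :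
    (∀ x : X, Vpol x = J x) ↔
      (∀ x : X,
        dotL lam (fun i => b i - B x (pol x) i) = 0 ∧
        ∀ a ∈ A x,
          R x a + dotL lam (fun i => b i - B x a i) + β * expH P J x a ≤
            R x (pol x) + dotL lam (fun i => b i - B x (pol x) i) + β * expH P J x (pol x)) := by
  have hslack : ∀ x, 0 ≤ dotL lam (fun i => b i - B x (pol x) i) := fun x =>
    Finset.sum_nonneg fun i _ => mul_nonneg (hlam i) (sub_nonneg.mpr ((hpol x).2 i))
  have hle : ∀ x, ∀ a ∈ A x,
      R x a + dotL lam (fun i => b i - B x a i) + β * expH P J x a ≤ J x := by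
    intro x a ha
    rw [hJ x]
    exact le_ciSup (f := fun a : A x =>
      R x a + dotL lam (fun i => b i - B x a i) + β * expH P J x a)
      (Set.finite_range _).bddAbove ⟨a, ha⟩
  constructor
  · intro hVJ x
    have hV := hVpol x
    rw [funext hVJ] at hV
    have hx := hle x (pol x) (hpol x).1
    have h0 : dotL lam (fun i => b i - B x (pol x) i) = 0 := by
      linarith [hslack x]
    refine ⟨h0, fun a ha => ?_⟩
    linarith [hle x a ha]
  · intro hopt
    have hJpol : ∀ x, J x = R x (pol x) + β * expH P J x (pol x) := by
      intro x
      obtain ⟨h0, hmax⟩ := hopt x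
      have : Nonempty (A x) := (hA x).to_subtype
      have hub : J x ≤
          R x (pol x) + dotL lam (fun i => b i - B x (pol x) i) + β * expH P J x (pol x) := by
        conv_lhs => rw [hJ x]
        exact ciSup_le fun a => hmax a a.2
      linarith [hle x (pol x) (hpol x).1]
    intro x
    refine sub_eq_zero.mp (eq_zero_of_eq_discounted_average (fun x => P x (pol x))
      (fun x => hP0 x (pol x)) (fun x => hP1 x (pol x)) hβ0.le hβ1
      (d := fun x => Vpol x - J x) (fun x => ?_) x)
    have hdiff : ∑ y, P x (pol x) y * (Vpol y - J y) =
        expH P Vpol x (pol x) - expH P J x (pol x) := by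
      simp only [expH, mul_sub, Finset.sum_sub_distrib]
    rw [hdiff]
    linarith [hVpol x, hJpol x]
end
end

section
/- Approximate linear programming bounds: (a) if (θ, (H^n)_{n=1}^{N}) satisfies the ALP constraints, then the function H(x) := θ + Σ_n H^n(x^n) satisfies R x a + β·E[H|x,a] ≤ H(x) for all x ∈ X and a ∈ Ā(x), and V(x) ≤ H(x) for all x ∈ X; (b) for every λ ∈ ℝ^L with λ ≥ 0 componentwise, the pair (λ·b/(1−β), (H^{λ,n})_{n=1}^{N}) satisfies the ALP constraints; (c) consequently, for every such λ and all probability weights υ = (υ_n), H^{LP}(υ) ≤ J^λ(υ). -/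
open MeasureTheory ProbabilityTheory

noncomputable section

/-- The feasible action set of the weakly coupled problem:
`Ā(x) = {a : a^n ∈ A^n(x^n) for all n, Σ_n B^n x^n a^n ≤ b componentwise}`. -/
def AbarW {N : ℕ} {Xn Actn : Fin N → Type*} {L : ℕ}
    (An : ∀ n, Xn n → Set (Actn n))
    (Bn : ∀ n, Xn n → Actn n → Fin L → ℝ) (b : Fin L → ℝ)
    (x : ∀ n, Xn n) : Set (∀ n, Actn n) :=
  {a | (∀ n, a n ∈ An n (x n)) ∧ ∀ i, ∑ n, Bn n (x n) (a n) i ≤ b i}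

/-- The ALP constraints on `(θ, (H^n)_n)`:
`θ(1−β) + Σ_n H^n(x^n) ≥ Σ_n R^n x^n a^n + β Σ_n Σ_y P_n x^n a^n y · H^n(y)`
for every state `x` and feasible action `a ∈ Ā(x)`. -/
def ALPfeasible {N : ℕ} {Xn Actn : Fin N → Type*}
    [∀ n, Fintype (Xn n)] {L : ℕ}
    (An : ∀ n, Xn n → Set (Actn n))
    (Pn : ∀ n, Xn n → Actn n → Xn n → ℝ)
    (Rn : ∀ n, Xn n → Actn n → ℝ)
    (Bn : ∀ n, Xn n → Actn n → Fin L → ℝ) (b : Fin L → ℝ)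
    (β : ℝ) (θ : ℝ) (Hs : ∀ n, Xn n → ℝ) : Prop :=
  ∀ (x : ∀ n, Xn n), ∀ a ∈ AbarW An Bn b x,
    (∑ n, Rn n (x n) (a n)) + β * ∑ n, ∑ y, Pn n (x n) (a n) y * Hs n y ≤
      θ * (1 - β) + ∑ n, Hs n (x n)

section ProductWeights

variable {ι : Type*} [Fintype ι] [DecidableEq ι] {S : ι → Type*} [∀ i, Fintype (S i)]

/-- A product of weights with total mass one has total mass one. -/
theorem sum_prod_weights_eq_one (p : ∀ i, S i → ℝ) (hp : ∀ i, ∑ z, p i z = 1) :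
    ∑ y : ∀ i, S i, ∏ i, p i (y i) = 1 := by
  have h := Finset.prod_univ_sum (fun i => (Finset.univ : Finset (S i))) p
  rw [Fintype.piFinset_univ] at h
  simp [← h, hp]

/-- The marginals of a product of probability weights are its factors. -/
theorem sum_prod_weights_mul_apply (p : ∀ i, S i → ℝ) (hp : ∀ i, ∑ z, p i z = 1)
    (f : ∀ i, S i → ℝ) (j : ι) :
    ∑ y : ∀ i, S i, (∏ i, p i (y i)) * f j (y j) = ∑ z, p j z * f j z := by
  have h := Finset.prod_univ_sum (fun i => (Finset.univ : Finset (S i)))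
    (fun i z => p i z * if i = j then f i z else 1)
  rw [Fintype.piFinset_univ] at h
  simp only [Finset.prod_mul_distrib, Finset.prod_ite_eq', Finset.mem_univ, if_true] at h
  rw [← h, Finset.prod_eq_single j]
  · simp
  · intro i _ hij
    simp [hij, hp]
  · simp

/-- Expectation of an additively separable function under a product of probability weights. -/
theorem sum_prod_weights_mul_const_add_sum (p : ∀ i, S i → ℝ) (hp : ∀ i, ∑ z, p i z = 1)
    (θ : ℝ) (f : ∀ i, S i → ℝ) :
    ∑ y : ∀ i, S i, (∏ i, p i (y i)) * (θ + ∑ i, f i (y i)) =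
      θ + ∑ i, ∑ z, p i z * f i z := by
  simp only [mul_add, Finset.mul_sum, Finset.sum_add_distrib]
  rw [← Finset.sum_mul, sum_prod_weights_eq_one p hp, one_mul, Finset.sum_comm]
  simp only [sum_prod_weights_mul_apply p hp f]

end ProductWeights

/-- A supersolution of a finite discounted Bellman equation dominates every solution. -/
theorem le_of_bellman_supersolution {X Act : Type*} [Fintype X] (A : X → Set Act)
    (hA : ∀ x, (A x).Nonempty) (P : X → Act → X → ℝ)
    (hP0 : ∀ x a y, 0 ≤ P x a y) (hP1 : ∀ x a, ∑ y, P x a y = 1)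
    (R : X → Act → ℝ) {β : ℝ} (hβ0 : 0 ≤ β) (hβ1 : β < 1) (V H : X → ℝ)
    (hV : ∀ x, V x = ⨆ a : A x, (R x a + β * ∑ y, P x a y * V y))
    (hH : ∀ x, ∀ a ∈ A x, R x a + β * ∑ y, P x a y * H y ≤ H x) (x : X) :
    V x ≤ H x := by
  have : Nonempty X := ⟨x⟩
  obtain ⟨x₀, hx₀⟩ := Finite.exists_max fun y => V y - H y
  have hle : V x₀ ≤ H x₀ + β * (V x₀ - H x₀) := by
    rw [hV x₀]
    have := (hA x₀).to_subtype
    refine ciSup_le fun a => ?_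
    rw [← hV x₀]
    have hsum : ∑ y, P x₀ a y * V y ≤ ∑ y, P x₀ a y * H y + (V x₀ - H x₀) :=
      calc ∑ y, P x₀ a y * V y
          ≤ ∑ y, P x₀ a y * (H y + (V x₀ - H x₀)) :=
            Finset.sum_le_sum fun y _ =>
              mul_le_mul_of_nonneg_left (by linarith [hx₀ y]) (hP0 _ _ _)
        _ = ∑ y, P x₀ a y * H y + (V x₀ - H x₀) := by
            simp only [mul_add, Finset.sum_add_distrib]
            rw [← Finset.sum_mul, hP1, one_mul]
    have := mul_le_mul_of_nonneg_left hsum hβ0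
    linarith [hH x₀ a a.2]
  have : V x₀ - H x₀ ≤ 0 := by nlinarith
  linarith [hx₀ x]

/-- approximate linear programming bounds: (a) any ALP-feasible pair yields
a supersolution and hence an upper bound on `V`; (b) the Lagrangian pair
`(λ·b/(1−β), (H^{λ,n})_n)` is ALP-feasible; (c) hence `H^{LP}(υ) ≤ J^λ(υ)`. -/
theorem approximate_linear_programming_bounds
    {N : ℕ} {Xn Actn : Fin N → Type*}
    [∀ n, Fintype (Xn n)] [∀ n, Fintype (Actn n)]
    [∀ n, Nonempty (Xn n)] [∀ n, Nonempty (Actn n)]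
    {L : ℕ}
    (An : ∀ n, Xn n → Set (Actn n)) (hAn : ∀ n x, (An n x).Nonempty)
    (Pn : ∀ n, Xn n → Actn n → Xn n → ℝ)
    (hPn0 : ∀ n x a y, 0 ≤ Pn n x a y) (hPn1 : ∀ n x a, ∑ y, Pn n x a y = 1)
    (Rn : ∀ n, Xn n → Actn n → ℝ)
    (Bn : ∀ n, Xn n → Actn n → Fin L → ℝ) (b : Fin L → ℝ)
    (β : ℝ) (hβ0 : 0 < β) (hβ1 : β < 1)
    (hAbar : ∀ x : ∀ n, Xn n, (AbarW An Bn b x).Nonempty)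
    (V : (∀ n, Xn n) → ℝ)
    (hV : ∀ x : ∀ n, Xn n, V x = ⨆ a : AbarW An Bn b x,
      ((∑ n, Rn n (x n) (a.1 n)) +
        β * ∑ y : ∀ n, Xn n, (∏ n, Pn n (x n) (a.1 n) (y n)) * V y))
    (Hlam : (Fin L → ℝ) → ∀ n, Xn n → ℝ)
    (hHlam : ∀ lam : Fin L → ℝ, (∀ i, 0 ≤ lam i) → ∀ n (x : Xn n),
      Hlam lam n x = ⨆ a : An n x,
        (Rn n x a - dotL lam (Bn n x a) + β * ∑ y, Pn n x a y * Hlam lam n y)) :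
    -- (a)
    (∀ (θ : ℝ) (Hs : ∀ n, Xn n → ℝ), ALPfeasible An Pn Rn Bn b β θ Hs →
      (∀ (x : ∀ n, Xn n), ∀ a ∈ AbarW An Bn b x,
        (∑ n, Rn n (x n) (a n)) +
            β * ∑ y : ∀ n, Xn n, (∏ n, Pn n (x n) (a n) (y n)) *
              (θ + ∑ n, Hs n (y n)) ≤
          θ + ∑ n, Hs n (x n)) ∧
      (∀ x : ∀ n, Xn n, V x ≤ θ + ∑ n, Hs n (x n))) ∧
    -- (b)
    (∀ lam : Fin L → ℝ, (∀ i, 0 ≤ lam i) →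
      ALPfeasible An Pn Rn Bn b β (dotL lam b / (1 - β)) (Hlam lam)) ∧
    -- (c)
    (∀ lam : Fin L → ℝ, (∀ i, 0 ≤ lam i) →
      ∀ υ : ∀ n, Xn n → ℝ, (∀ n x, 0 ≤ υ n x) → (∀ n, ∑ x, υ n x = 1) →
        sInf { v | ∃ (θ : ℝ) (Hs : ∀ n, Xn n → ℝ), ALPfeasible An Pn Rn Bn b β θ Hs ∧
            v = θ + ∑ n, ∑ x, υ n x * Hs n x } ≤
          dotL lam b / (1 - β) + ∑ n, ∑ x, υ n x * Hlam lam n x) := by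
  have supersol : ∀ (θ : ℝ) (Hs : ∀ n, Xn n → ℝ), ALPfeasible An Pn Rn Bn b β θ Hs →
      ∀ (x : ∀ n, Xn n), ∀ a ∈ AbarW An Bn b x,
        (∑ n, Rn n (x n) (a n)) +
            β * ∑ y : ∀ n, Xn n, (∏ n, Pn n (x n) (a n) (y n)) *
              (θ + ∑ n, Hs n (y n)) ≤
          θ + ∑ n, Hs n (x n) := by
    intro θ Hs h x a ha
    rw [sum_prod_weights_mul_const_add_sum (fun n => Pn n (x n) (a n))
      (fun n => hPn1 n _ _)]
    linarith [h x a ha]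
  have upper : ∀ (θ : ℝ) (Hs : ∀ n, Xn n → ℝ), ALPfeasible An Pn Rn Bn b β θ Hs →
      ∀ x : ∀ n, Xn n, V x ≤ θ + ∑ n, Hs n (x n) := by
    intro θ Hs h
    exact le_of_bellman_supersolution (AbarW An Bn b) hAbar
      (fun x a y => ∏ n, Pn n (x n) (a n) (y n))
      (fun x a y => Finset.prod_nonneg fun n _ => hPn0 _ _ _ _)
      (fun x a => sum_prod_weights_eq_one (fun n => Pn n (x n) (a n)) fun n => hPn1 n _ _)
      (fun x a => ∑ n, Rn n (x n) (a n)) hβ0.le hβ1 V (fun x => θ + ∑ n, Hs n (x n)) hV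
      (supersol θ Hs h)
  have lagrangian : ∀ lam : Fin L → ℝ, (∀ i, 0 ≤ lam i) →
      ALPfeasible An Pn Rn Bn b β (dotL lam b / (1 - β)) (Hlam lam) := by
    intro lam hlam x a ha
    have hn : ∀ n, Rn n (x n) (a n) - dotL lam (Bn n (x n) (a n)) +
        β * ∑ y, Pn n (x n) (a n) y * Hlam lam n y ≤ Hlam lam n (x n) := by
      intro n
      rw [hHlam lam hlam n (x n)]
      exact le_ciSup (f := fun c : An n (x n) => Rn n (x n) c - dotL lam (Bn n (x n) c) +
        β * ∑ y, Pn n (x n) c y * Hlam lam n y) (Set.finite_range _).bddAbove ⟨a n, ha.1 n⟩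
    have hsum := Finset.sum_le_sum fun n (_ : n ∈ Finset.univ) => hn n
    simp only [Finset.sum_add_distrib, Finset.sum_sub_distrib, ← Finset.mul_sum] at hsum
    have hlink : ∑ n, dotL lam (Bn n (x n) (a n)) ≤ dotL lam b := by
      simp only [dotL]
      rw [Finset.sum_comm]
      refine Finset.sum_le_sum fun i _ => ?_
      rw [← Finset.mul_sum]
      exact mul_le_mul_of_nonneg_left (ha.2 i) (hlam i)
    rw [div_mul_cancel₀ _ (sub_pos.2 hβ1).ne']
    linarith
  refine ⟨fun θ Hs h => ⟨supersol θ Hs h, upper θ Hs h⟩, lagrangian, ?_⟩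
  intro lam hlam υ hυ0 hυ1
  refine csInf_le ⟨∑ x : ∀ n, Xn n, (∏ n, υ n (x n)) * V x, ?_⟩
    ⟨_, _, lagrangian lam hlam, rfl⟩
  rintro v ⟨θ, Hs, h, rfl⟩
  rw [← sum_prod_weights_mul_const_add_sum υ hυ1]
  exact Finset.sum_le_sum fun x _ =>
    mul_le_mul_of_nonneg_left (upper θ Hs h x) (Finset.prod_nonneg fun n _ => hυ0 _ _)
end
end
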